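/- arXiv:1609.00581 — 13 statements merged into one kernel-verified Lean document; each statement's English description precedes it below -/
import Mathlib

section
/- Let n be a positive integer and A₁ ∈ ℂ^{n×n}. Run the AB-algorithm with B₁ = I (the n×n identity matrix), and suppose the iteration is breakdown-free up to step k (i.e., A₁ + B_j is invertible for all 1 ≤ j < k). Then the matrix ∑_{j=0}^{k-1} A₁^j is invertible, and A_k = A₁^k (∑_{j=0}^{k-1} A₁^j)^{-1} and B_k = (∑_{j=0}^{k-1} A₁^j)^{-1}. -/
open Matrix BigOperators

theorem Commute.matrix_nonsing_inv_right {m R : Type*} [Fintype m] [DecidableEq m] [CommRing R]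
    {M N : Matrix m m R} (h : Commute M N) : Commute M N⁻¹ := by
  by_cases hN : IsUnit N
  · obtain ⟨u, rfl⟩ := hN
    rw [← Matrix.coe_units_inv]
    exact h.units_inv_right
  · rw [Matrix.nonsing_inv_apply_not_isUnit _ (mt (Matrix.isUnit_iff_isUnit_det N).2 hN)]
    exact Commute.zero_right M

/-- With `B₁ = I`, if the AB-algorithm is breakdown-free up to step `k`, then
`∑_{j=0}^{k-1} A₁^j` is invertible, `A_k = A₁^k (∑_{j=0}^{k-1} A₁^j)⁻¹` and
`B_k = (∑_{j=0}^{k-1} A₁^j)⁻¹`. -/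
theorem ab_algorithm_identity_B (n : ℕ) (hn : 0 < n) (A₁ : Matrix (Fin n) (Fin n) ℂ)
    (A B : ℕ → Matrix (Fin n) (Fin n) ℂ)
    (hA1 : A 1 = A₁) (hB1 : B 1 = (1 : Matrix (Fin n) (Fin n) ℂ))
    (hrecA : ∀ j, 1 ≤ j → A (j + 1) = A 1 * (A 1 + B j)⁻¹ * A j)
    (hrecB : ∀ j, 1 ≤ j → B (j + 1) = B j * (A 1 + B j)⁻¹ * B 1)
    (k : ℕ) (hk : 1 ≤ k)
    (hinv : ∀ j, 1 ≤ j → j < k → IsUnit (A 1 + B j)) :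
    IsUnit (∑ j ∈ Finset.range k, A₁ ^ j) ∧
      A k = A₁ ^ k * (∑ j ∈ Finset.range k, A₁ ^ j)⁻¹ ∧
      B k = (∑ j ∈ Finset.range k, A₁ ^ j)⁻¹ := by
  subst hA1
  induction k, hk using Nat.le_induction with
  | base => simp [hB1]
  | succ k hk ih =>
    obtain ⟨hS, hA, hB⟩ := ih fun j hj hjk => hinv j hj (hjk.trans k.lt_succ_self)
    have hM := hinv k hk k.lt_succ_self
    have hcomm : Commute (A 1) (∑ j ∈ Finset.range k, A 1 ^ j) :=
      Commute.sum_right _ _ _ fun j _ => Commute.self_pow (A 1) j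
    have hsum := geom_sum_succ (x := A 1) (n := k)
    set S := ∑ j ∈ Finset.range k, A 1 ^ j
    have hdet := (Matrix.isUnit_iff_isUnit_det S).1 hS
    have hcommM : Commute (A 1) (A 1 + B k) :=
      (Commute.refl _).add_right (hB ▸ hcomm.matrix_nonsing_inv_right)
    have hleft : ∑ j ∈ Finset.range (k + 1), A 1 ^ j = (A 1 + B k) * S := by
      rw [hsum, hB, add_mul, Matrix.nonsing_inv_mul _ hdet]
    have hright : ∑ j ∈ Finset.range (k + 1), A 1 ^ j = S * (A 1 + B k) := by
      rw [hsum, hB, mul_add, Matrix.mul_nonsing_inv _ hdet, hcomm.eq]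
    refine ⟨hleft ▸ hM.mul hS, ?_, ?_⟩
    · rw [hrecA k hk, hright, Matrix.mul_inv_rev, hA, pow_succ', mul_assoc, mul_assoc,
        ← mul_assoc _ (A 1 ^ k), ← (hcommM.matrix_nonsing_inv_right.pow_left k).eq, mul_assoc]
    · rw [hrecB k hk, hleft, Matrix.mul_inv_rev, hB1, mul_one, hB]
end

section
/- Let A₁, B₁ ∈ ℂ^{n×n} and suppose the AB-algorithm is breakdown-free up to step k. If λ ∈ ℂ and x ∈ ℂⁿ is a nonzero vector with A₁ x = λ B₁ x, then A_k x = λ^k B_k x; in particular λ^k is a finite eigenvalue of the matrix pencil A_k − μ B_k (there exists a nonzero vector y with A_k y = λ^k B_k y). -/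
open Matrix BigOperators

/-- If `M + N` is invertible, then `M (M + N)⁻¹ N = N (M + N)⁻¹ M`. -/
theorem Matrix.mul_inv_add_mul_comm {ι R : Type*} [Fintype ι] [DecidableEq ι] [CommRing R]
    (M N : Matrix ι ι R) (h : IsUnit (M + N)) :
    M * (M + N)⁻¹ * N = N * (M + N)⁻¹ * M := by
  have hdet := (Matrix.isUnit_iff_isUnit_det _).1 h
  have hl : M * (M + N)⁻¹ + N * (M + N)⁻¹ = 1 := by
    rw [← add_mul, Matrix.mul_nonsing_inv _ hdet]
  have hr : N * (M + N)⁻¹ * M + N * (M + N)⁻¹ * N = N := by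
    rw [← mul_add, Matrix.mul_assoc, Matrix.nonsing_inv_mul _ hdet, mul_one]
  rw [eq_sub_of_add_eq hl, sub_mul, one_mul, eq_sub_of_add_eq hr]

/-- If `A₁ x = λ B₁ x` with `x ≠ 0` and the AB-algorithm is breakdown-free up to
step `k`, then `A_k x = λ^k B_k x`; in particular `λ^k` is a finite eigenvalue of the pencil
`A_k − μ B_k`. -/
theorem ab_algorithm_eigenvalue_power (n : ℕ) (hn : 0 < n)
    (A B : ℕ → Matrix (Fin n) (Fin n) ℂ)
    (hrecA : ∀ j, 1 ≤ j → A (j + 1) = A 1 * (A 1 + B j)⁻¹ * A j)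
    (hrecB : ∀ j, 1 ≤ j → B (j + 1) = B j * (A 1 + B j)⁻¹ * B 1)
    (k : ℕ) (hk : 1 ≤ k)
    (hinv : ∀ j, 1 ≤ j → j < k → IsUnit (A 1 + B j))
    (lam : ℂ) (x : Fin n → ℂ) (hx : x ≠ 0)
    (heig : A 1 *ᵥ x = lam • (B 1 *ᵥ x)) :
    A k *ᵥ x = lam ^ k • (B k *ᵥ x) ∧
      ∃ y : Fin n → ℂ, y ≠ 0 ∧ A k *ᵥ y = lam ^ k • (B k *ᵥ y) := by
  have main : A k *ᵥ x = lam ^ k • (B k *ᵥ x) := by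
    induction k, hk using Nat.le_induction with
    | base => simpa using heig
    | succ j hj ih =>
      have ih' := ih fun i hi hij => hinv i hi (hij.trans j.lt_succ_self)
      rw [hrecA j hj, hrecB j hj, ← mulVec_mulVec, ih', mulVec_smul, mulVec_mulVec,
        Matrix.mul_inv_add_mul_comm _ _ (hinv j hj j.lt_succ_self), ← mulVec_mulVec, heig,
        mulVec_smul, mulVec_mulVec, smul_smul, pow_succ]
  exact ⟨main, x, hx, main⟩
end

section
/- Let A₁, B₁ ∈ ℂ^{n×n} and suppose the AB-algorithm is breakdown-free up to step k. If λ ∈ ℂ and x ∈ ℂⁿ is a nonzero vector with A₁ x = λ B₁ x, then A₁ x = (∑_{s=1}^{k} λ^s) B_k x; in particular ∑_{s=1}^{k} λ^s is a finite eigenvalue of the pencil A₁ − μ B_k. -/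
open Matrix BigOperators

/-- If `x` is an eigenvector of the pencils `A - μ B` and `A - μ C` with eigenvalues `b` and `c`,
then it is one of `A - μ (C (A + C)⁻¹ B)` with eigenvalue `b (1 + c)`. -/
theorem mulVec_eq_smul_mulVec_mul_inv_mul {ι R : Type*} [Fintype ι] [DecidableEq ι] [CommRing R]
    {A B C : Matrix ι ι R} (hM : IsUnit (A + C)) {b c : R} {x : ι → R}
    (hB : A *ᵥ x = b • (B *ᵥ x)) (hC : A *ᵥ x = c • (C *ᵥ x)) :
    A *ᵥ x = (b * (1 + c)) • ((C * (A + C)⁻¹ * B) *ᵥ x) := by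
  have hAC : (1 + c) • (C *ᵥ x) = (A + C) *ᵥ x := by
    rw [add_mulVec, hC, add_smul, one_smul, add_comm]
  symm
  calc (b * (1 + c)) • ((C * (A + C)⁻¹ * B) *ᵥ x)
      = (1 + c) • ((C * (A + C)⁻¹) *ᵥ (b • (B *ᵥ x))) := by
        rw [mulVec_smul, mulVec_mulVec, smul_smul, mul_comm b]
    _ = c • ((C * (A + C)⁻¹) *ᵥ ((1 + c) • (C *ᵥ x))) := by
        rw [← hB, hC, mulVec_smul, mulVec_smul, smul_comm]
    _ = c • (C *ᵥ x) := by
        rw [hAC, mulVec_mulVec, Matrix.mul_assoc,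
          nonsing_inv_mul _ ((isUnit_iff_isUnit_det _).mp hM), Matrix.mul_one]
    _ = A *ᵥ x := hC.symm

theorem geom_sum_Icc_succ {R : Type*} [CommSemiring R] (r : R) (j : ℕ) :
    ∑ s ∈ Finset.Icc 1 (j + 1), r ^ s = r * (1 + ∑ s ∈ Finset.Icc 1 j, r ^ s) := by
  induction j with
  | zero => simp
  | succ j ih =>
    nth_rw 1 [Finset.sum_Icc_succ_top (by omega), ih]
    rw [Finset.sum_Icc_succ_top (by omega)]
    ring

/-- If `A₁ x = λ B₁ x` with `x ≠ 0` and the AB-algorithm is breakdown-free up to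
step `k`, then `A₁ x = (∑_{s=1}^k λ^s) B_k x`; in particular `∑_{s=1}^k λ^s` is a finite
eigenvalue of the pencil `A₁ − μ B_k`. -/
theorem ab_algorithm_eigenvalue_geom_sum (n : ℕ) (hn : 0 < n)
    (A B : ℕ → Matrix (Fin n) (Fin n) ℂ)
    (hrecA : ∀ j, 1 ≤ j → A (j + 1) = A 1 * (A 1 + B j)⁻¹ * A j)
    (hrecB : ∀ j, 1 ≤ j → B (j + 1) = B j * (A 1 + B j)⁻¹ * B 1)
    (k : ℕ) (hk : 1 ≤ k)
    (hinv : ∀ j, 1 ≤ j → j < k → IsUnit (A 1 + B j))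
    (lam : ℂ) (x : Fin n → ℂ) (hx : x ≠ 0)
    (heig : A 1 *ᵥ x = lam • (B 1 *ᵥ x)) :
    A 1 *ᵥ x = (∑ s ∈ Finset.Icc 1 k, lam ^ s) • (B k *ᵥ x) ∧
      ∃ y : Fin n → ℂ, y ≠ 0 ∧
        A 1 *ᵥ y = (∑ s ∈ Finset.Icc 1 k, lam ^ s) • (B k *ᵥ y) := by
  suffices h : A 1 *ᵥ x = (∑ s ∈ Finset.Icc 1 k, lam ^ s) • (B k *ᵥ x) from ⟨h, x, hx, h⟩
  induction k, hk using Nat.le_induction with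
  | base => simpa using heig
  | succ j hj ih =>
    have hM := hinv j hj j.lt_succ_self
    rw [hrecB j hj, geom_sum_Icc_succ]
    exact mulVec_eq_smul_mulVec_mul_inv_mul hM heig
      (ih fun i hi hij => hinv i hi (hij.trans j.lt_succ_self))
end

section
/- Let A₁, B₁ ∈ ℂ^{n×n} and suppose the AB-algorithm is breakdown-free up to step i. If λ ∈ ℂ and x ∈ ℂⁿ is a nonzero vector with A₁ x = λ B₁ x, then (∑_{s=0}^{i-1} λ^s) · A_i x = λ^i · B₁ x; in particular, if ∑_{s=0}^{i-1} λ^s ≠ 0, then λ^i / (∑_{s=0}^{i-1} λ^s) is a finite eigenvalue of the pencil A_i − μ B₁. -/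
open Matrix BigOperators

/-- The difference `A k - B k` is invariant under one step of the AB-algorithm. -/
theorem ab_step_sub {m R : Type*} [Fintype m] [DecidableEq m] [CommRing R]
    {A₁ B₁ A B : Matrix m m R} (hM : IsUnit (A₁ + B)) (h : A - B = A₁ - B₁) :
    A₁ * (A₁ + B)⁻¹ * A - B * (A₁ + B)⁻¹ * B₁ = A₁ - B₁ := by
  have hdet := (Matrix.isUnit_iff_isUnit_det _).mp hM
  have hA : A = (A₁ + B) - B₁ := by rw [sub_eq_iff_eq_add.mp h]; abel
  have h₁ : A₁ * (A₁ + B)⁻¹ * (A₁ + B) = A₁ := Matrix.nonsing_inv_mul_cancel_right _ _ hdet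
  have h₂ : A₁ * (A₁ + B)⁻¹ + B * (A₁ + B)⁻¹ = 1 := by
    rw [← add_mul, Matrix.mul_nonsing_inv _ hdet]
  calc A₁ * (A₁ + B)⁻¹ * A - B * (A₁ + B)⁻¹ * B₁
      = A₁ * (A₁ + B)⁻¹ * (A₁ + B) - (A₁ * (A₁ + B)⁻¹ + B * (A₁ + B)⁻¹) * B₁ := by
        rw [hA]; noncomm_ring
    _ = A₁ - B₁ := by rw [h₁, h₂, one_mul]

/-- How the `B`-part of the AB-algorithm acts on an eigenvector of `A₁ - μ B₁`. -/
theorem ab_step_smul_mulVec {m R : Type*} [Fintype m] [DecidableEq m] [CommRing R]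
    {A₁ B₁ B : Matrix m m R} (hM : IsUnit (A₁ + B)) {c s : R} {x : m → R}
    (heig : A₁ *ᵥ x = c • (B₁ *ᵥ x)) (h : s • (B *ᵥ x) = B₁ *ᵥ x) :
    (c * s + 1) • ((B * (A₁ + B)⁻¹ * B₁) *ᵥ x) = B₁ *ᵥ x := by
  have hdet := (Matrix.isUnit_iff_isUnit_det _).mp hM
  have hsum : (c * s + 1) • (B₁ *ᵥ x) = (A₁ + B) *ᵥ (s • x) := by
    rw [Matrix.mulVec_smul, Matrix.add_mulVec, smul_add, h, heig, smul_smul, add_smul, one_smul,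
      mul_comm c s]
  calc (c * s + 1) • ((B * (A₁ + B)⁻¹ * B₁) *ᵥ x)
      = (B * (A₁ + B)⁻¹) *ᵥ ((c * s + 1) • (B₁ *ᵥ x)) := by
        rw [Matrix.mulVec_smul, Matrix.mulVec_mulVec]
    _ = B *ᵥ (s • x) := by
        rw [hsum, Matrix.mulVec_mulVec, Matrix.nonsing_inv_mul_cancel_right _ _ hdet]
    _ = B₁ *ᵥ x := by rw [Matrix.mulVec_smul, h]

/-- If `A₁ x = λ B₁ x` with `x ≠ 0` and the AB-algorithm is breakdown-free up to
step `i`, then `(∑_{s=0}^{i-1} λ^s) • (A_i x) = λ^i • (B₁ x)`; in particular if the sum is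
nonzero then `λ^i / ∑_{s=0}^{i-1} λ^s` is a finite eigenvalue of the pencil `A_i − μ B₁`. -/
theorem ab_algorithm_eigenvalue_Ai_B1 (n : ℕ) (hn : 0 < n)
    (A B : ℕ → Matrix (Fin n) (Fin n) ℂ)
    (hrecA : ∀ j, 1 ≤ j → A (j + 1) = A 1 * (A 1 + B j)⁻¹ * A j)
    (hrecB : ∀ j, 1 ≤ j → B (j + 1) = B j * (A 1 + B j)⁻¹ * B 1)
    (i : ℕ) (hi : 1 ≤ i)
    (hinv : ∀ j, 1 ≤ j → j < i → IsUnit (A 1 + B j))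
    (lam : ℂ) (x : Fin n → ℂ) (hx : x ≠ 0)
    (heig : A 1 *ᵥ x = lam • (B 1 *ᵥ x)) :
    (∑ s ∈ Finset.range i, lam ^ s) • (A i *ᵥ x) = lam ^ i • (B 1 *ᵥ x) ∧
      ((∑ s ∈ Finset.range i, lam ^ s) ≠ 0 →
        ∃ y : Fin n → ℂ, y ≠ 0 ∧
          A i *ᵥ y = (lam ^ i / ∑ s ∈ Finset.range i, lam ^ s) • (B 1 *ᵥ y)) := by
  have key : A i - B i = A 1 - B 1 ∧
      (∑ s ∈ Finset.range i, lam ^ s) • (B i *ᵥ x) = B 1 *ᵥ x := by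
    induction i, hi using Nat.le_induction with
    | base => simp
    | succ k hk ih =>
      obtain ⟨hsub, hB⟩ := ih fun j hj hjk => hinv j hj (hjk.trans k.lt_succ_self)
      have hM := hinv k hk k.lt_succ_self
      rw [hrecA k hk, hrecB k hk, geom_sum_succ]
      exact ⟨ab_step_sub hM hsub, ab_step_smul_mulVec hM heig hB⟩
  obtain ⟨hsub, hB⟩ := key
  have main : (∑ s ∈ Finset.range i, lam ^ s) • (A i *ᵥ x) = lam ^ i • (B 1 *ᵥ x) := by
    have hgeom := sub_eq_iff_eq_add.mp (geom_sum_mul lam i).symm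
    rw [sub_eq_iff_eq_add.mp hsub, Matrix.add_mulVec, Matrix.sub_mulVec, smul_add, hB, heig, hgeom]
    module
  refine ⟨main, fun hs => ⟨x, hx, ?_⟩⟩
  rw [div_eq_inv_mul, mul_smul, ← main, inv_smul_smul₀ hs]
end

section
/- Let A₁, B₁ ∈ ℂ^{n×n} and suppose the AB-algorithm is breakdown-free up to step max(i,k). If λ ∈ ℂ and x ∈ ℂⁿ is a nonzero vector with A₁ x = λ B₁ x, then (∑_{s=0}^{i-1} λ^s) · A_i x = λ^i (∑_{s=0}^{k-1} λ^s) · B_k x; in particular, if ∑_{s=0}^{i-1} λ^s ≠ 0, then λ^i (∑_{s=0}^{k-1} λ^s)/(∑_{s=0}^{i-1} λ^s) is a finite eigenvalue of the pencil A_i − μ B_k. -/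
open Matrix BigOperators

section ABIteration

variable {ι K : Type*} [Fintype ι] [DecidableEq ι] [Field K] {A B : ℕ → Matrix ι ι K}
  {m : ℕ} {l : K} {x : ι → K}

/-- If `B_k x` is known up to the geometric sum, so is the solution of `(A₁ + B_k) y = B₁ x`. -/
theorem geom_sum_smul_inv_mulVec {k : ℕ} (h : IsUnit (A 1 + B k))
    (heig : A 1 *ᵥ x = l • (B 1 *ᵥ x))
    (hB : (∑ s ∈ Finset.range k, l ^ s) • (B k *ᵥ x) = B 1 *ᵥ x) :
    (∑ s ∈ Finset.range (k + 1), l ^ s) • ((A 1 + B k)⁻¹ *ᵥ (B 1 *ᵥ x))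
      = (∑ s ∈ Finset.range k, l ^ s) • x := by
  have hM : (∑ s ∈ Finset.range k, l ^ s) • ((A 1 + B k) *ᵥ x)
      = (∑ s ∈ Finset.range (k + 1), l ^ s) • (B 1 *ᵥ x) := by
    rw [add_mulVec, smul_add, hB, heig, geom_sum_succ]
    module
  rw [← mulVec_smul, ← hM, mulVec_smul, mulVec_mulVec,
    nonsing_inv_mul _ ((isUnit_iff_isUnit_det _).1 h), one_mulVec]

theorem geom_sum_smul_B_mulVec
    (hrecB : ∀ j, 1 ≤ j → B (j + 1) = B j * (A 1 + B j)⁻¹ * B 1)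
    (hinv : ∀ j, 1 ≤ j → j < m → IsUnit (A 1 + B j))
    (heig : A 1 *ᵥ x = l • (B 1 *ᵥ x)) {k : ℕ} (hk : 1 ≤ k) (hkm : k ≤ m) :
    (∑ s ∈ Finset.range k, l ^ s) • (B k *ᵥ x) = B 1 *ᵥ x := by
  induction k, hk using Nat.le_induction with
  | base => simp
  | succ k hk ih =>
    have hB := ih (by omega)
    rw [hrecB k hk, ← mulVec_mulVec, ← mulVec_mulVec, ← mulVec_smul,
      geom_sum_smul_inv_mulVec (hinv k hk (by omega)) heig hB, mulVec_smul, hB]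

theorem geom_sum_smul_A_mulVec
    (hrecA : ∀ j, 1 ≤ j → A (j + 1) = A 1 * (A 1 + B j)⁻¹ * A j)
    (hrecB : ∀ j, 1 ≤ j → B (j + 1) = B j * (A 1 + B j)⁻¹ * B 1)
    (hinv : ∀ j, 1 ≤ j → j < m → IsUnit (A 1 + B j)) (hx : x ≠ 0)
    (heig : A 1 *ᵥ x = l • (B 1 *ᵥ x)) {i : ℕ} (hi : 1 ≤ i) (him : i ≤ m) :
    (∑ s ∈ Finset.range i, l ^ s) • (A i *ᵥ x) = l ^ i • (B 1 *ᵥ x) := by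
  induction i, hi using Nat.le_induction with
  | base => simpa using heig
  | succ i hi ih =>
    have hA := ih (by omega)
    have hB := geom_sum_smul_B_mulVec hrecB hinv heig hi (by omega)
    have hS : (∑ s ∈ Finset.range i, l ^ s) ≠ 0 := by
      intro hS
      have hB0 : B 1 *ᵥ x = 0 := by rw [← hB, hS, zero_smul]
      refine hx (mulVec_injective_iff_isUnit.2 (hinv 1 le_rfl (by omega)) ?_)
      simp [add_mulVec, heig, hB0]
    have hinvB := geom_sum_smul_inv_mulVec (hinv i hi (by omega)) heig hB
    refine smul_right_injective _ hS ?_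
    beta_reduce
    rw [smul_comm, hrecA i hi, ← mulVec_mulVec, ← mulVec_mulVec, ← mulVec_smul,
      ← mulVec_smul, ← mulVec_smul (A 1 + B i)⁻¹, hA,
      mulVec_smul (A 1 + B i)⁻¹, smul_comm _ (l ^ i), hinvB, mulVec_smul, mulVec_smul, heig]
    module

end ABIteration

/-- If `A₁ x = λ B₁ x` with `x ≠ 0` and the AB-algorithm is breakdown-free up to
step `max i k`, then `(∑_{s=0}^{i-1} λ^s) • (A_i x) = λ^i (∑_{s=0}^{k-1} λ^s) • (B_k x)`;
in particular if `∑_{s=0}^{i-1} λ^s ≠ 0` then `λ^i (∑_{s=0}^{k-1} λ^s)/(∑_{s=0}^{i-1} λ^s)`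
is a finite eigenvalue of the pencil `A_i − μ B_k`. -/
theorem ab_algorithm_eigenvalue_Ai_Bk (n : ℕ) (hn : 0 < n)
    (A B : ℕ → Matrix (Fin n) (Fin n) ℂ)
    (hrecA : ∀ j, 1 ≤ j → A (j + 1) = A 1 * (A 1 + B j)⁻¹ * A j)
    (hrecB : ∀ j, 1 ≤ j → B (j + 1) = B j * (A 1 + B j)⁻¹ * B 1)
    (i k : ℕ) (hi : 1 ≤ i) (hk : 1 ≤ k)
    (hinv : ∀ j, 1 ≤ j → j < max i k → IsUnit (A 1 + B j))
    (lam : ℂ) (x : Fin n → ℂ) (hx : x ≠ 0)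
    (heig : A 1 *ᵥ x = lam • (B 1 *ᵥ x)) :
    (∑ s ∈ Finset.range i, lam ^ s) • (A i *ᵥ x)
        = (lam ^ i * ∑ s ∈ Finset.range k, lam ^ s) • (B k *ᵥ x) ∧
      ((∑ s ∈ Finset.range i, lam ^ s) ≠ 0 →
        ∃ y : Fin n → ℂ, y ≠ 0 ∧
          A i *ᵥ y = (lam ^ i * (∑ s ∈ Finset.range k, lam ^ s)
              / ∑ s ∈ Finset.range i, lam ^ s) • (B k *ᵥ y)) := by
  have hA := geom_sum_smul_A_mulVec hrecA hrecB hinv hx heig hi (le_max_left i k)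
  have hB := geom_sum_smul_B_mulVec hrecB hinv heig hk (le_max_right i k)
  have key : (∑ s ∈ Finset.range i, lam ^ s) • (A i *ᵥ x)
      = (lam ^ i * ∑ s ∈ Finset.range k, lam ^ s) • (B k *ᵥ x) := by
    rw [hA, mul_smul, hB]
  refine ⟨key, fun hS => ⟨x, hx, ?_⟩⟩
  rw [div_eq_inv_mul, mul_smul, ← key, inv_smul_smul₀ hS]
end

section
/- Let A₁, B₁ ∈ ℂ^{n×n} form a regular pencil (there exists z ∈ ℂ with det(A₁ − z B₁) ≠ 0). Fix a positive integer k, and suppose that for every integer p with 2 ≤ p ≤ k+1 and every integer q with 1 ≤ q ≤ p−1, det(A₁ − e^{2πiq/p} B₁) ≠ 0 (i.e., no p-th root of unity other than 1 is an eigenvalue of the pencil A₁ − λB₁). Then A₁ + B_j is invertible for every 1 ≤ j ≤ k, i.e., the AB-algorithm is breakdown-free up to step k+1. -/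
open Matrix BigOperators

/-- The polynomial `∑_{i < p} X ^ i (1 + z X) ^ (p - 1 - i)`. -/
noncomputable def geomPoly (z : ℂ) (p : ℕ) : Polynomial ℂ :=
  ∑ i ∈ Finset.range p,
    Polynomial.X ^ i * (1 + Polynomial.C z * Polynomial.X) ^ (p - 1 - i)

lemma geomPoly_succ (z : ℂ) (p : ℕ) :
    geomPoly z (p + 1) =
      Polynomial.X ^ p + (1 + Polynomial.C z * Polynomial.X) * geomPoly z p := by
  simpa [geomPoly] using
    (Commute.all (Polynomial.X : Polynomial ℂ) (1 + Polynomial.C z * Polynomial.X)).geom_sum₂_succ_eq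
      (n := p)

lemma geomPoly_eq_prod (z : ℂ) {p : ℕ} (hp : 0 < p) :
    geomPoly z p = ∏ ζ ∈ (Polynomial.nthRootsFinset p (1 : Polynomial ℂ)).erase 1,
      (1 + Polynomial.C z * Polynomial.X - ζ * Polynomial.X) := by
  have hprim : IsPrimitiveRoot (Polynomial.C (Complex.exp (2 * Real.pi * Complex.I / p))) p :=
    (Complex.isPrimitiveRoot_exp p hp.ne').map_of_injective Polynomial.C_injective
  have hne : (1 + Polynomial.C z * Polynomial.X - 1 * Polynomial.X : Polynomial ℂ) ≠ 0 := by
    intro h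
    simpa using congrArg (Polynomial.eval 0) h
  apply mul_left_cancel₀ hne
  rw [Finset.mul_prod_erase _ (fun ζ => 1 + Polynomial.C z * Polynomial.X - ζ * Polynomial.X)
    ((Polynomial.mem_nthRootsFinset hp 1).2 (one_pow p)),
    ← hprim.pow_sub_pow_eq_prod_sub_mul _ _ hp]
  have h := (Commute.all (Polynomial.X : Polynomial ℂ)
    (1 + Polynomial.C z * Polynomial.X)).geom_sum₂_mul p
  rw [geomPoly]
  linear_combination -h

lemma isUnit_aeval_prod {R ι : Type*} [Ring R] [Algebra ℂ R] (b : R) (s : Finset ι)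
    (f : ι → Polynomial ℂ) (h : ∀ i ∈ s, IsUnit (Polynomial.aeval b (f i))) :
    IsUnit (Polynomial.aeval b (∏ i ∈ s, f i)) := by
  classical
  induction s using Finset.induction_on with
  | empty => simp
  | insert i s hi ih =>
    rw [Finset.prod_insert hi, map_mul]
    exact (h i (Finset.mem_insert_self i s)).mul
      (ih fun j hj => h j (Finset.mem_insert_of_mem hj))

lemma isUnit_aeval_geomPoly {R : Type*} [Ring R] [Algebra ℂ R] (b : R) (z : ℂ) {p : ℕ}
    (hp : 0 < p)
    (h : ∀ q : ℕ, 1 ≤ q → q ≤ p - 1 →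
      IsUnit (1 + z • b - Complex.exp (2 * Real.pi * Complex.I * q / p) • b)) :
    IsUnit (Polynomial.aeval b (geomPoly z p)) := by
  rw [geomPoly_eq_prod z hp]
  refine isUnit_aeval_prod b _ _ fun ζ hζ => ?_
  obtain ⟨hζ1, hζ⟩ := Finset.mem_erase.1 hζ
  have hprim : IsPrimitiveRoot (Polynomial.C (Complex.exp (2 * Real.pi * Complex.I / p))) p :=
    (Complex.isPrimitiveRoot_exp p hp.ne').map_of_injective Polynomial.C_injective
  have : NeZero p := ⟨hp.ne'⟩
  obtain ⟨q, hq, rfl⟩ := hprim.eq_pow_of_pow_eq_one ((Polynomial.mem_nthRootsFinset hp 1).1 hζ)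
  have hq0 : q ≠ 0 := by
    rintro rfl
    exact hζ1 (pow_zero _)
  have hexp : Complex.exp (2 * Real.pi * Complex.I / p) ^ q =
      Complex.exp (2 * Real.pi * Complex.I * q / p) := by
    rw [← Complex.exp_nat_mul]
    congr 1
    ring
  rw [← Polynomial.C_pow, hexp]
  simpa [Algebra.smul_def] using h q (by lia) (by lia)

/-- For a regular pencil `A₁ − λB₁`, if no `p`-th root of unity other than `1`
(for `2 ≤ p ≤ k+1`) is an eigenvalue of the pencil, then `A₁ + B_j` is invertible for every
`1 ≤ j ≤ k`, i.e. the AB-algorithm is breakdown-free up to step `k+1`. -/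
theorem ab_algorithm_well_defined (n : ℕ) (hn : 0 < n)
    (A B : ℕ → Matrix (Fin n) (Fin n) ℂ)
    (hrecA : ∀ j, 1 ≤ j → A (j + 1) = A 1 * (A 1 + B j)⁻¹ * A j)
    (hrecB : ∀ j, 1 ≤ j → B (j + 1) = B j * (A 1 + B j)⁻¹ * B 1)
    (hreg : ∃ z : ℂ, (A 1 - z • B 1).det ≠ 0)
    (k : ℕ) (hk : 1 ≤ k)
    (hroots : ∀ p q : ℕ, 2 ≤ p → p ≤ k + 1 → 1 ≤ q → q ≤ p - 1 →
      (A 1 - Complex.exp (2 * Real.pi * Complex.I * q / p) • B 1).det ≠ 0) :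
    ∀ j, 1 ≤ j → j ≤ k → IsUnit (A 1 + B j) := by
  obtain ⟨z, hz⟩ := hreg
  set M := A 1 - z • B 1 with hM
  have hMu : IsUnit M.det := isUnit_iff_ne_zero.2 hz
  obtain ⟨b, hb⟩ : ∃ b, b = M⁻¹ * B 1 := ⟨_, rfl⟩
  have hMb : M * b = B 1 := by rw [hb, mul_nonsing_inv_cancel_left _ _ hMu]
  have hMa : M * (1 + z • b) = A 1 := by
    rw [mul_add, mul_one, mul_smul_comm, hMb, hM, sub_add_cancel]
  set S : ℕ → Matrix (Fin n) (Fin n) ℂ := fun p => Polynomial.aeval b (geomPoly z p) with hS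
  have hSsucc (p : ℕ) : S (p + 1) = b ^ p + (1 + z • b) * S p := by
    simp [hS, geomPoly_succ, Algebra.smul_def]
  have hSu (p : ℕ) (hp : 1 ≤ p) (hpk : p ≤ k + 1) : IsUnit (S p) := by
    refine isUnit_aeval_geomPoly b z hp fun q hq hqp => ?_
    have h := hroots p q (by lia) hpk hq hqp
    rw [← hMa, ← hMb, ← Matrix.mul_smul, ← mul_sub, det_mul] at h
    exact (isUnit_iff_isUnit_det _).2 (isUnit_iff_ne_zero.2 (right_ne_zero_of_mul h))
  have hSdet (p : ℕ) (hp : 1 ≤ p) (hpk : p ≤ k + 1) : IsUnit (S p).det :=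
    (isUnit_iff_isUnit_det _).1 (hSu p hp hpk)
  have hsum (j : ℕ) (hj : 1 ≤ j) (hjk : j ≤ k) (hB : B j = M * (b ^ j * (S j)⁻¹)) :
      A 1 + B j = M * (S (j + 1) * (S j)⁻¹) := by
    rw [hB, ← hMa, ← mul_add, hSsucc, add_mul,
      mul_nonsing_inv_cancel_right _ _ (hSdet j hj (by lia)), add_comm (b ^ j * _)]
  have hform (j : ℕ) (hj : 1 ≤ j) : j ≤ k → B j = M * (b ^ j * (S j)⁻¹) := by
    induction j, hj using Nat.le_induction with
    | base => simp [hS, geomPoly, hMb]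
    | succ j hj ih =>
      intro hjk
      have hB := ih (by lia)
      have hcomm : Commute (S (j + 1)) b := by
        simpa [hS] using
          (Commute.all (geomPoly z (j + 1)) Polynomial.X).map (Polynomial.aeval b)
      have hinv : (S (j + 1))⁻¹ * b = b * (S (j + 1))⁻¹ := by
        have hu := hSdet (j + 1) (by lia) (by lia)
        calc (S (j + 1))⁻¹ * b = (S (j + 1))⁻¹ * (b * S (j + 1)) * (S (j + 1))⁻¹ := by
              rw [mul_assoc, mul_nonsing_inv_cancel_right _ _ hu]
          _ = b * (S (j + 1))⁻¹ := by
              rw [← hcomm.eq, nonsing_inv_mul_cancel_left _ _ hu]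
      calc B (j + 1) = M * (b ^ j * (S j)⁻¹) * (M * (S (j + 1) * (S j)⁻¹))⁻¹ * B 1 := by
            rw [hrecB j hj, hsum j hj (by lia) hB, hB]
        _ = M * (b ^ j * ((S j)⁻¹ * S j) * ((S (j + 1))⁻¹ * b)) := by
            rw [Matrix.mul_inv_rev, Matrix.mul_inv_rev,
              nonsing_inv_nonsing_inv _ (hSdet j hj (by lia)), hb]
            simp only [mul_assoc]
        _ = M * (b ^ (j + 1) * (S (j + 1))⁻¹) := by
            rw [nonsing_inv_mul _ (hSdet j hj (by lia)), hinv, mul_one, pow_succ, mul_assoc]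
  intro j hj hjk
  rw [hsum j hj hjk (hform j hj hjk)]
  exact ((isUnit_iff_isUnit_det _).2 hMu).mul
    ((hSu (j + 1) (by lia) (by lia)).mul (isUnit_nonsing_inv_iff.2 (hSu j hj (by lia))))
end

section
/- Let A₁, B₁ ∈ ℂ^{n×n} and suppose the AB-algorithm is breakdown-free up to step k. Then A_k − B_k = A₁ − B₁. -/
open Matrix BigOperators

/-- If the AB-algorithm is breakdown-free up to step `k`, then
`A_k − B_k = A₁ − B₁`. -/
theorem ab_algorithm_difference_invariant (n : ℕ) (hn : 0 < n)
    (A B : ℕ → Matrix (Fin n) (Fin n) ℂ)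
    (hrecA : ∀ j, 1 ≤ j → A (j + 1) = A 1 * (A 1 + B j)⁻¹ * A j)
    (hrecB : ∀ j, 1 ≤ j → B (j + 1) = B j * (A 1 + B j)⁻¹ * B 1)
    (k : ℕ) (hk : 1 ≤ k)
    (hinv : ∀ j, 1 ≤ j → j < k → IsUnit (A 1 + B j)) :
    A k - B k = A 1 - B 1 := by
  induction k, hk using Nat.le_induction with
  | base => rfl
  | succ k hk ih =>
    have hdet := (Matrix.isUnit_iff_isUnit_det _).mp (hinv k hk k.lt_succ_self)
    have hA : A k = (A 1 + B k) - B 1 := by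
      rw [sub_eq_iff_eq_add.mp (ih fun j h1 hj => hinv j h1 (hj.trans k.lt_succ_self))]
      abel
    have hA' : A (k + 1) = A 1 - A 1 * (A 1 + B k)⁻¹ * B 1 := by
      rw [hrecA k hk, hA, mul_sub, Matrix.nonsing_inv_mul_cancel_right _ _ hdet]
    have hB' : B (k + 1) = B 1 - A 1 * (A 1 + B k)⁻¹ * B 1 := by
      have h : B k * (A 1 + B k)⁻¹ = 1 - A 1 * (A 1 + B k)⁻¹ := by
        rw [eq_sub_iff_add_eq', ← add_mul, Matrix.mul_nonsing_inv _ hdet]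
      rw [hrecB k hk, h, sub_mul, one_mul]
    rw [hA', hB', sub_sub_sub_cancel_right]
end

section
/- Let A₁, B₁ ∈ ℂ^{n×n} and let i, j be positive integers. Suppose the AB-algorithm is breakdown-free up to step i + j. Then A_i + B_j is invertible, and A_{i+j} = A_i (A_i + B_j)^{-1} A_j and B_{i+j} = B_j (A_i + B_j)^{-1} B_i. -/
open Matrix BigOperators

section Ring

variable {R : Type*} [Ring R] {a b : R}

/-- The relation `a * c * b = b * c * a` passes from `c` to the inverse of `a + b - a * c * b`. -/
lemma mul_inv_mul_comm_step {c s t : R} (hc : a * c * b = b * c * a)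
    (hs : s = a + b - a * c * b) (hst : s * t = 1) (hts : t * s = 1) :
    a * t * b = b * t * a := by
  have hcomm : (1 - b * c) * s = s * (1 - c * b) := by
    have h : a * c * b * (c * b) = b * c * (a * c * b) := by
      nth_rewrite 1 [hc]; noncomm_ring
    have e : (1 - b * c) * s - s * (1 - c * b) =
        (a * c * b - b * c * a) - (a * c * b * (c * b) - b * c * (a * c * b)) := by
      rw [hs]; noncomm_ring
    rw [← sub_eq_zero, e, h, hc]; simp
  have hinv : t * (1 - b * c) = (1 - c * b) * t := by
    calc t * (1 - b * c) = t * ((1 - b * c) * s) * t := by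
          rw [mul_assoc, mul_assoc (1 - b * c), hst, mul_one]
      _ = (1 - c * b) * t := by rw [hcomm, ← mul_assoc, hts, one_mul]
  have hl : s - b = (1 - b * c) * a := by rw [hs, hc]; noncomm_ring
  have hr : s - b = a * (1 - c * b) := by rw [hs]; noncomm_ring
  have key : a * t * (s - b) = (s - b) * t * a := by
    calc a * t * (s - b) = a * (t * (1 - b * c)) * a := by rw [hl]; noncomm_ring
      _ = (s - b) * t * a := by rw [hinv, hr]; noncomm_ring
  have e1 : a * t * (s - b) = a - a * t * b := by
    rw [mul_sub, mul_assoc a t s, hts, mul_one]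
  have e2 : (s - b) * t * a = a - b * t * a := by
    rw [sub_mul, sub_mul, hst, one_mul]
  rw [e1, e2] at key
  exact sub_right_injective key

/-- A one-sided form of the Woodbury identity. -/
lemma sub_mul_woodbury_eq_one {s t s' t' w : R} (hst : s * t = 1)
    (hts' : t' * s' = 1) (hw : (s' - b * t * a) * w = 1) :
    (s - a * t' * b) * (t + t * a * w * b * t) = 1 := by
  have e : (s - a * t' * b) * (t + t * a * w * b * t) =
      s * t + (s * t) * a * w * b * t - a * t' * b * t
        - a * t' * (s' * w - (s' - b * t * a) * w) * b * t := by noncomm_ring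
  have e' : a * t' * (s' * w - 1) * b * t = a * (t' * s') * w * b * t - a * t' * b * t := by
    noncomm_ring
  rw [e, hw, e', hst, hts']
  noncomm_ring

lemma mul_eq_mul_of_mul_eq_mul {x y p q p' q' : R} (hp : p' * p = 1) (hq : q * q' = 1)
    (h : p * x = y * q) : x * q' = p' * y := by
  calc x * q' = p' * (p * x) * q' := by rw [← mul_assoc p', hp, one_mul]
    _ = p' * y := by rw [h, mul_assoc, mul_assoc, hq, mul_one]

end Ring

section ABAlgorithm

variable {ι K : Type*} [Fintype ι] [DecidableEq ι] [CommRing K] {A B : ℕ → Matrix ι ι K}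

lemma ab_algorithm_succ_left
    (hrecA : ∀ j, 1 ≤ j → A (j + 1) = A 1 * (A 1 + B j)⁻¹ * A j)
    (k : ℕ) (hk : 1 ≤ k) (hinv : IsUnit (A 1 + B k)) (hcomm : A k + B 1 = A 1 + B k) :
    A (k + 1) = A 1 - A 1 * (A 1 + B k)⁻¹ * B 1 := by
  have hu := (isUnit_iff_isUnit_det _).1 hinv
  have hA : A k = (A 1 + B k) - B 1 := by rw [← hcomm]; abel
  rw [hrecA k hk]
  conv_lhs => rw [hA]
  rw [mul_sub, nonsing_inv_mul_cancel_right _ _ hu]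

lemma ab_algorithm_succ_right
    (hrecB : ∀ j, 1 ≤ j → B (j + 1) = B j * (A 1 + B j)⁻¹ * B 1)
    (k : ℕ) (hk : 1 ≤ k) (hinv : IsUnit (A 1 + B k)) :
    B (k + 1) = B 1 - A 1 * (A 1 + B k)⁻¹ * B 1 := by
  have hu := (isUnit_iff_isUnit_det _).1 hinv
  have hB : B k = (A 1 + B k) - A 1 := by abel
  rw [hrecB k hk]
  conv_lhs => enter [1, 1]; rw [hB]
  rw [sub_mul, mul_nonsing_inv _ hu, sub_mul, one_mul]

lemma ab_algorithm_add_comm_one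
    (hrecA : ∀ j, 1 ≤ j → A (j + 1) = A 1 * (A 1 + B j)⁻¹ * A j)
    (hrecB : ∀ j, 1 ≤ j → B (j + 1) = B j * (A 1 + B j)⁻¹ * B 1)
    (k : ℕ) (hk : 1 ≤ k) (hinv : ∀ l, 1 ≤ l → l < k → IsUnit (A 1 + B l)) :
    A k + B 1 = A 1 + B k := by
  induction k, hk using Nat.le_induction with
  | base => rfl
  | succ k hk ih =>
    have ih := ih fun l h1 h2 => hinv l h1 (by omega)
    have hu := hinv k hk (by omega)
    rw [ab_algorithm_succ_left hrecA k hk hu ih, ab_algorithm_succ_right hrecB k hk hu]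
    abel

lemma ab_algorithm_mul_inv_mul_comm
    (hrecB : ∀ j, 1 ≤ j → B (j + 1) = B j * (A 1 + B j)⁻¹ * B 1)
    (k : ℕ) (hk : 1 ≤ k) (hinv : ∀ l, 1 ≤ l → l ≤ k → IsUnit (A 1 + B l)) :
    A 1 * (A 1 + B k)⁻¹ * B 1 = B 1 * (A 1 + B k)⁻¹ * A 1 := by
  induction k, hk using Nat.le_induction with
  | base =>
    have hu := (isUnit_iff_isUnit_det _).1 (hinv 1 le_rfl le_rfl)
    refine mul_inv_mul_comm_step (c := 0) (s := A 1 + B 1) (by simp) (by simp)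
      (mul_nonsing_inv _ hu) (nonsing_inv_mul _ hu)
  | succ k hk ih =>
    have ih := ih fun l h1 h2 => hinv l h1 (by omega)
    have hu := (isUnit_iff_isUnit_det _).1 (hinv (k + 1) (by omega) le_rfl)
    refine mul_inv_mul_comm_step (s := A 1 + B (k + 1)) ih ?_
      (mul_nonsing_inv _ hu) (nonsing_inv_mul _ hu)
    rw [ab_algorithm_succ_right hrecB k hk (hinv k hk (by omega))]
    abel

end ABAlgorithm

/-- (discrete-type flow) If the AB-algorithm is breakdown-free up to step `i + j`,
then `A_i + B_j` is invertible, `A_{i+j} = A_i (A_i + B_j)⁻¹ A_j` and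
`B_{i+j} = B_j (A_i + B_j)⁻¹ B_i`. -/
theorem ab_algorithm_semigroup_property (n : ℕ) (hn : 0 < n)
    (A B : ℕ → Matrix (Fin n) (Fin n) ℂ)
    (hrecA : ∀ j, 1 ≤ j → A (j + 1) = A 1 * (A 1 + B j)⁻¹ * A j)
    (hrecB : ∀ j, 1 ≤ j → B (j + 1) = B j * (A 1 + B j)⁻¹ * B 1)
    (i j : ℕ) (hi : 1 ≤ i) (hj : 1 ≤ j)
    (hinv : ∀ l, 1 ≤ l → l < i + j → IsUnit (A 1 + B l)) :
    IsUnit (A i + B j) ∧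
      A (i + j) = A i * (A i + B j)⁻¹ * A j ∧
      B (i + j) = B j * (A i + B j)⁻¹ * B i := by
  induction i, hi using Nat.le_induction generalizing j with
  | base =>
    refine ⟨hinv j hj (by omega), ?_, ?_⟩
    · rw [add_comm, hrecA j hj]
    · rw [add_comm, hrecB j hj]
  | succ i hi ih =>
    obtain ⟨hU, hA, hB⟩ := ih (j + 1) (by omega) fun l h1 h2 => hinv l h1 (by omega)
    have hinvi : ∀ l, 1 ≤ l → l ≤ i → IsUnit (A 1 + B l) := fun l h1 h2 => hinv l h1 (by omega)
    have hinvj : ∀ l, 1 ≤ l → l ≤ j → IsUnit (A 1 + B l) := fun l h1 h2 => hinv l h1 (by omega)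
    have hui := (isUnit_iff_isUnit_det _).1 (hinvi i hi le_rfl)
    have huj := (isUnit_iff_isUnit_det _).1 (hinvj j hj le_rfl)
    have hi' := ab_algorithm_add_comm_one hrecA hrecB i hi fun l h1 h2 => hinvi l h1 h2.le
    have symi := ab_algorithm_mul_inv_mul_comm hrecB i hi hinvi
    have symj := ab_algorithm_mul_inv_mul_comm hrecB j hj hinvj
    have hAi : A (i + 1) = A i * (A 1 + B i)⁻¹ * A 1 := by
      have h : A i = (A 1 + B i) - B 1 := by rw [← hi']; abel
      conv_rhs => enter [1, 1]; rw [h]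
      rw [sub_mul, mul_nonsing_inv _ hui, sub_mul, one_mul, ← symi,
        ab_algorithm_succ_left hrecA i hi (hinvi i hi le_rfl) hi']
    have hBi : B (i + 1) = B 1 * (A 1 + B i)⁻¹ * B i := by
      have h : B i = (A 1 + B i) - A 1 := by abel
      conv_rhs => enter [2]; rw [h]
      rw [mul_sub, nonsing_inv_mul_cancel_right _ _ hui, ← symi,
        ab_algorithm_succ_right hrecB i hi (hinvi i hi le_rfl)]
    have eS : A i + B (j + 1) = (A 1 + B i) - B 1 * (A 1 + B j)⁻¹ * A 1 := by
      rw [ab_algorithm_succ_right hrecB j hj (hinvj j hj le_rfl), ← symj, ← hi']; abel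
    have eQ : A (i + 1) + B j = (A 1 + B j) - A 1 * (A 1 + B i)⁻¹ * B 1 := by
      rw [ab_algorithm_succ_left hrecA i hi (hinvi i hi le_rfl) hi']; abel
    have huS := (isUnit_iff_isUnit_det _).1 hU
    have hQ : IsUnit (A (i + 1) + B j) := by
      have hw := mul_nonsing_inv _ huS
      nth_rewrite 1 [eS] at hw
      rw [eQ]
      exact IsUnit.of_mul_eq_one _
        (sub_mul_woodbury_eq_one (mul_nonsing_inv _ huj) (nonsing_inv_mul _ hui) hw)
    have huQ := (isUnit_iff_isUnit_det _).1 hQ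
    have keyA : (A 1 + B i)⁻¹ * A 1 * (A (i + 1) + B j)⁻¹ =
        (A i + B (j + 1))⁻¹ * (A 1 * (A 1 + B j)⁻¹) := by
      refine mul_eq_mul_of_mul_eq_mul (nonsing_inv_mul _ huS) (mul_nonsing_inv _ huQ) ?_
      rw [eS, eQ, sub_mul, mul_nonsing_inv_cancel_left _ _ hui, mul_sub,
        nonsing_inv_mul_cancel_right _ _ huj, symi, ← symj]
      simp only [mul_assoc]
    have keyB : (A 1 + B j)⁻¹ * B 1 * (A i + B (j + 1))⁻¹ =
        (A (i + 1) + B j)⁻¹ * (B 1 * (A 1 + B i)⁻¹) := by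
      refine mul_eq_mul_of_mul_eq_mul (nonsing_inv_mul _ huQ) (mul_nonsing_inv _ huS) ?_
      rw [eS, eQ, sub_mul, mul_nonsing_inv_cancel_left _ _ huj, mul_sub,
        nonsing_inv_mul_cancel_right _ _ hui, symi, ← symj]
      simp only [mul_assoc]
    have eidx : i + 1 + j = i + (j + 1) := by omega
    refine ⟨hQ, ?_, ?_⟩
    · calc A (i + 1 + j) = A i * ((A i + B (j + 1))⁻¹ * (A 1 * (A 1 + B j)⁻¹)) * A j := by
            rw [eidx, hA, hrecA j hj]; simp only [mul_assoc]
        _ = A i * (A 1 + B i)⁻¹ * A 1 * (A (i + 1) + B j)⁻¹ * A j := by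
            rw [← keyA]; simp only [mul_assoc]
        _ = A (i + 1) * (A (i + 1) + B j)⁻¹ * A j := by rw [← hAi]
    · calc B (i + 1 + j) = B j * ((A 1 + B j)⁻¹ * B 1 * (A i + B (j + 1))⁻¹) * B i := by
            rw [eidx, hB, hrecB j hj]; simp only [mul_assoc]
        _ = B j * (A (i + 1) + B j)⁻¹ * (B 1 * (A 1 + B i)⁻¹ * B i) := by
            rw [keyB]; simp only [mul_assoc]
        _ = B j * (A (i + 1) + B j)⁻¹ * B (i + 1) := by rw [← hBi]
end

section
/- Let A₁, B₁ ∈ ℂ^{n×n}, suppose the AB-algorithm is breakdown-free up to step k, and let U ∈ ℂ^{n×m} and Λ ∈ ℂ^{m×m} satisfy A₁ U = B₁ U Λ. Then A₁ U = B_k U (∑_{j=1}^{k} Λ^j). -/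
open Matrix BigOperators

/-- If `A₁ U = B₁ U Λ` and the AB-algorithm is breakdown-free up to step `k`,
then `A₁ U = B_k U (∑_{j=1}^k Λ^j)`. -/
theorem ab_algorithm_deflating_subspace_sum (n m : ℕ) (hn : 0 < n)
    (A B : ℕ → Matrix (Fin n) (Fin n) ℂ)
    (hrecA : ∀ j, 1 ≤ j → A (j + 1) = A 1 * (A 1 + B j)⁻¹ * A j)
    (hrecB : ∀ j, 1 ≤ j → B (j + 1) = B j * (A 1 + B j)⁻¹ * B 1)
    (k : ℕ) (hk : 1 ≤ k)
    (hinv : ∀ j, 1 ≤ j → j < k → IsUnit (A 1 + B j))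
    (U : Matrix (Fin n) (Fin m) ℂ) (Λ : Matrix (Fin m) (Fin m) ℂ)
    (hU : A 1 * U = B 1 * U * Λ) :
    A 1 * U = B k * U * ∑ j ∈ Finset.Icc 1 k, Λ ^ j := by
  induction k, hk using Nat.le_induction with
  | base => simpa using hU
  | succ k hk ih =>
    have ih := ih fun j h1 hj => hinv j h1 (hj.trans k.lt_succ_self)
    have hdet := (Matrix.isUnit_iff_isUnit_det _).mp (hinv k hk k.lt_succ_self)
    have hsum : ∑ j ∈ Finset.Icc 1 (k + 1), Λ ^ j =
        Λ * (1 + ∑ j ∈ Finset.Icc 1 k, Λ ^ j) := by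
      rw [← Finset.Ico_add_one_right_eq_Icc, ← Finset.Ico_add_one_right_eq_Icc,
        ← Finset.sum_Ico_add' _ 0 (k + 1) 1, Finset.sum_eq_sum_Ico_succ_bot k.succ_pos]
      simp only [mul_add, Finset.mul_sum, pow_succ', pow_zero, zero_add, Nat.succ_eq_add_one]
    rw [hsum, hrecB k hk]
    generalize ∑ j ∈ Finset.Icc 1 k, Λ ^ j = S at ih
    have hshift : A 1 * U * (1 + S) = (A 1 + B k) * (U * S) := by
      calc A 1 * U * (1 + S) = A 1 * U + A 1 * U * S := by rw [Matrix.mul_add, Matrix.mul_one]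
        _ = B k * U * S + A 1 * U * S := by rw [← ih]
        _ = (A 1 + B k) * (U * S) := by
          rw [Matrix.add_mul, Matrix.mul_assoc, Matrix.mul_assoc, add_comm]
    symm
    calc B k * (A 1 + B k)⁻¹ * B 1 * U * (Λ * (1 + S))
        = B k * ((A 1 + B k)⁻¹ * (B 1 * U * Λ * (1 + S))) := by simp only [Matrix.mul_assoc]
      _ = B k * (U * S) := by
        rw [← hU, hshift, Matrix.nonsing_inv_mul_cancel_left _ _ hdet]
      _ = A 1 * U := by rw [ih, Matrix.mul_assoc]
end

section
/- Let A₁, B₁ ∈ ℂ^{n×n}, suppose the AB-algorithm is breakdown-free up to step k, and let U ∈ ℂ^{n×m} and Λ ∈ ℂ^{m×m} satisfy A₁ U = B₁ U Λ. Then A_k U = B_k U Λ^k. If in addition I_m − Λ^k is invertible, then A_k U = (B₁ − A₁) U Λ^k (I_m − Λ^k)^{-1}. -/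
open Matrix BigOperators

/-- `X (X + Y)⁻¹ Y = Y (X + Y)⁻¹ X`: the parallel sum of two matrices is symmetric. -/
theorem Matrix.mul_add_inv_mul_comm {ι R : Type*} [Fintype ι] [DecidableEq ι] [CommRing R]
    {X Y : Matrix ι ι R} (h : IsUnit (X + Y)) :
    X * (X + Y)⁻¹ * Y = Y * (X + Y)⁻¹ * X := by
  have hdet := (Matrix.isUnit_iff_isUnit_det _).1 h
  have h₁ : X * (X + Y)⁻¹ * (X + Y) = X := Matrix.nonsing_inv_mul_cancel_right _ _ hdet
  have h₂ : (X + Y) * ((X + Y)⁻¹ * X) = X := Matrix.mul_nonsing_inv_cancel_left _ _ hdet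
  rw [mul_add] at h₁
  rw [add_mul, ← mul_assoc, ← mul_assoc] at h₂
  exact add_left_cancel (h₁.trans h₂.symm)

/-- The difference `B_k - A_k` is invariant under the AB-algorithm. -/
theorem ab_algorithm_sub_eq {ι R : Type*} [Fintype ι] [DecidableEq ι] [CommRing R]
    {A B : ℕ → Matrix ι ι R}
    (hrecA : ∀ j, 1 ≤ j → A (j + 1) = A 1 * (A 1 + B j)⁻¹ * A j)
    (hrecB : ∀ j, 1 ≤ j → B (j + 1) = B j * (A 1 + B j)⁻¹ * B 1)
    {k : ℕ} (hk : 1 ≤ k) (hinv : ∀ j, 1 ≤ j → j < k → IsUnit (A 1 + B j)) :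
    B k - A k = B 1 - A 1 := by
  induction k, hk using Nat.le_induction with
  | base => rfl
  | succ k hk ih =>
    have hdet := (Matrix.isUnit_iff_isUnit_det _).1 (hinv k hk k.lt_succ_self)
    have hA : A k = (A 1 + B k) - B 1 := by
      rw [← sub_sub_self (B k) (A k), ih fun j h₁ h₂ => hinv j h₁ (h₂.trans k.lt_succ_self)]
      abel
    have h₁ : A 1 * (A 1 + B k)⁻¹ * (A 1 + B k) = A 1 :=
      Matrix.nonsing_inv_mul_cancel_right _ _ hdet
    have h₂ : (A 1 + B k) * ((A 1 + B k)⁻¹ * B 1) = B 1 :=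
      Matrix.mul_nonsing_inv_cancel_left _ _ hdet
    rw [add_mul, ← mul_assoc, ← mul_assoc] at h₂
    have hA' : A (k + 1) = A 1 - A 1 * (A 1 + B k)⁻¹ * B 1 := by
      rw [hrecA k hk]
      conv_lhs => rw [hA, mul_sub, h₁]
    rw [hA', hrecB k hk, eq_sub_of_add_eq' h₂]
    abel

/-- The AB-algorithm maps a deflating subspace relation to its `k`-th power. -/
theorem ab_algorithm_mul_eq {ι κ R : Type*} [Fintype ι] [DecidableEq ι] [Fintype κ]
    [DecidableEq κ] [CommRing R] {A B : ℕ → Matrix ι ι R}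
    (hrecA : ∀ j, 1 ≤ j → A (j + 1) = A 1 * (A 1 + B j)⁻¹ * A j)
    (hrecB : ∀ j, 1 ≤ j → B (j + 1) = B j * (A 1 + B j)⁻¹ * B 1)
    {k : ℕ} (hk : 1 ≤ k) (hinv : ∀ j, 1 ≤ j → j < k → IsUnit (A 1 + B j))
    {U : Matrix ι κ R} {Λ : Matrix κ κ R} (hU : A 1 * U = B 1 * U * Λ) :
    A k * U = B k * U * Λ ^ k := by
  induction k, hk using Nat.le_induction with
  | base => rw [pow_one, hU]
  | succ k hk ih =>
    calc A (k + 1) * U = A 1 * (A 1 + B k)⁻¹ * (A k * U) := by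
          rw [hrecA k hk, Matrix.mul_assoc]
      _ = A 1 * (A 1 + B k)⁻¹ * B k * U * Λ ^ k := by
          rw [ih fun j h₁ h₂ => hinv j h₁ (h₂.trans k.lt_succ_self)]
          simp only [Matrix.mul_assoc]
      _ = B k * (A 1 + B k)⁻¹ * (A 1 * U) * Λ ^ k := by
          rw [Matrix.mul_add_inv_mul_comm (hinv k hk k.lt_succ_self)]
          simp only [Matrix.mul_assoc]
      _ = B (k + 1) * U * Λ ^ (k + 1) := by
          rw [hU, hrecB k hk, pow_succ']
          simp only [Matrix.mul_assoc]

/-- If `A₁ U = B₁ U Λ` and the AB-algorithm is breakdown-free up to step `k`,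
then `A_k U = B_k U Λ^k`; if moreover `I − Λ^k` is invertible, then
`A_k U = (B₁ − A₁) U Λ^k (I − Λ^k)⁻¹`. -/
theorem ab_algorithm_deflating_subspace_power (n m : ℕ) (hn : 0 < n)
    (A B : ℕ → Matrix (Fin n) (Fin n) ℂ)
    (hrecA : ∀ j, 1 ≤ j → A (j + 1) = A 1 * (A 1 + B j)⁻¹ * A j)
    (hrecB : ∀ j, 1 ≤ j → B (j + 1) = B j * (A 1 + B j)⁻¹ * B 1)
    (k : ℕ) (hk : 1 ≤ k)
    (hinv : ∀ j, 1 ≤ j → j < k → IsUnit (A 1 + B j))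
    (U : Matrix (Fin n) (Fin m) ℂ) (Λ : Matrix (Fin m) (Fin m) ℂ)
    (hU : A 1 * U = B 1 * U * Λ) :
    A k * U = B k * U * Λ ^ k ∧
      (IsUnit ((1 : Matrix (Fin m) (Fin m) ℂ) - Λ ^ k) →
        A k * U = (B 1 - A 1) * U * Λ ^ k * ((1 : Matrix (Fin m) (Fin m) ℂ) - Λ ^ k)⁻¹) := by
  have hpow := ab_algorithm_mul_eq hrecA hrecB hk hinv hU
  refine ⟨hpow, fun hunit => ?_⟩
  have hmul : A k * U * (1 - Λ ^ k) = (B 1 - A 1) * U * Λ ^ k := by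
    rw [← ab_algorithm_sub_eq hrecA hrecB hk hinv, Matrix.mul_sub, Matrix.mul_one,
      Matrix.sub_mul, Matrix.sub_mul, ← hpow]
  rw [← hmul, Matrix.mul_nonsing_inv_cancel_right _ _ ((Matrix.isUnit_iff_isUnit_det _).1 hunit)]
end

section
/- Let S ∈ ℂ^{n×n}, γ > 0, and run the AB-algorithm with the 2n×2n initial matrices A₁ = [[γI, −I], [−S, γI]] and B₁ = [[γI, I], [S, γI]] (block form). If the Q-iteration is breakdown-free up to step k (γI + Q_j invertible for all 1 ≤ j < k), then the AB-algorithm is breakdown-free up to step k, and for every 1 ≤ j ≤ k the iterates have the block structure A_j = [[Q_j, −I], [−S, Q_j]] and B_j = [[Q_j, I], [S, Q_j]]. -/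
open Matrix BigOperators

theorem fromBlocks_a_add_b {m R : Type*} [DecidableEq m] [CommRing R]
    {S X : Matrix m m R} {c : R} :
    fromBlocks (c • (1 : Matrix m m R)) (-1) (-S) (c • 1) + fromBlocks X 1 S X =
      fromBlocks (c • 1 + X) 0 0 (c • 1 + X) := by
  simp [fromBlocks_add]

section

variable {m R : Type*} [Fintype m] [DecidableEq m] [CommRing R]

theorem Matrix.commute_nonsing_inv_right {M T : Matrix m m R} (h : Commute T M) :
    Commute T M⁻¹ := by
  by_cases hM : IsUnit M
  · obtain ⟨u, rfl⟩ := hM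
    rw [← Matrix.coe_units_inv]
    exact h.units_inv_right
  · rw [Matrix.nonsing_inv_apply_not_isUnit M (mt (Matrix.isUnit_iff_isUnit_det M).mpr hM)]
    exact Commute.zero_right T

theorem Matrix.inv_fromBlocks_diagonal {M : Matrix m m R} (h : IsUnit M) :
    (fromBlocks M 0 0 M)⁻¹ = fromBlocks M⁻¹ 0 0 M⁻¹ := by
  have hd := (Matrix.isUnit_iff_isUnit_det M).mp h
  apply Matrix.inv_eq_right_inv
  simp [fromBlocks_multiply, Matrix.mul_nonsing_inv M hd]

theorem Matrix.isUnit_fromBlocks_diagonal {M : Matrix m m R} (h : IsUnit M) :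
    IsUnit (fromBlocks M 0 0 M) := by
  have hd := (Matrix.isUnit_iff_isUnit_det M).mp h
  rw [Matrix.isUnit_iff_isUnit_det, det_fromBlocks_zero₂₁]
  exact hd.mul hd

variable {S X : Matrix m m R} {c : R}

theorem commute_q_step (hSX : Commute S X) :
    Commute S ((c • X + S) * (c • (1 : Matrix m m R) + X)⁻¹) :=
  ((hSX.smul_right c).add_right (Commute.refl S)).mul_right
    (Matrix.commute_nonsing_inv_right (((Commute.one_right S).smul_right c).add_right hSX))

theorem fromBlocks_a_step (hM : IsUnit (c • (1 : Matrix m m R) + X)) (hSX : Commute S X) :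
    fromBlocks (c • (1 : Matrix m m R)) (-1) (-S) (c • 1) *
        (fromBlocks (c • (1 : Matrix m m R)) (-1) (-S) (c • 1) + fromBlocks X 1 S X)⁻¹ *
        fromBlocks X (-1) (-S) X =
      fromBlocks ((c • X + S) * (c • (1 : Matrix m m R) + X)⁻¹) (-1) (-S)
        ((c • X + S) * (c • (1 : Matrix m m R) + X)⁻¹) := by
  have hcX : Commute X (c • (1 : Matrix m m R) + X) :=
    ((Commute.one_right X).smul_right c).add_right (Commute.refl X)
  have hX := Matrix.commute_nonsing_inv_right hcX
  have hS := Matrix.commute_nonsing_inv_right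
    (((Commute.one_right S).smul_right c).add_right hSX)
  have hinv := Matrix.mul_nonsing_inv _ ((Matrix.isUnit_iff_isUnit_det _).mp hM)
  rw [fromBlocks_a_add_b, Matrix.inv_fromBlocks_diagonal hM]
  generalize (c • (1 : Matrix m m R) + X)⁻¹ = N at *
  have hone : c • N + X * N = 1 := by simpa [add_mul] using hinv
  simp only [fromBlocks_multiply]
  congr 1
  · simp [add_mul, hX.eq, hS.eq]
  · calc _ = -(c • N + X * N) := by simp [← hX.eq, add_comm]
      _ = -1 := by rw [hone]
  · calc _ = -(S * (c • N + X * N)) := by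
          simp [mul_assoc, mul_add, ← hX.eq, ← hS.eq, add_comm]
      _ = -S := by rw [hone, mul_one]
  · simp [add_mul, hX.eq, add_comm]

theorem fromBlocks_b_step (hM : IsUnit (c • (1 : Matrix m m R) + X)) (hSX : Commute S X) :
    fromBlocks X 1 S X *
        (fromBlocks (c • (1 : Matrix m m R)) (-1) (-S) (c • 1) + fromBlocks X 1 S X)⁻¹ *
        fromBlocks (c • (1 : Matrix m m R)) 1 S (c • 1) =
      fromBlocks ((c • X + S) * (c • (1 : Matrix m m R) + X)⁻¹) 1 S
        ((c • X + S) * (c • (1 : Matrix m m R) + X)⁻¹) := by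
  have hS := Matrix.commute_nonsing_inv_right
    (((Commute.one_right S).smul_right c).add_right hSX)
  have hinv := Matrix.mul_nonsing_inv _ ((Matrix.isUnit_iff_isUnit_det _).mp hM)
  rw [fromBlocks_a_add_b, Matrix.inv_fromBlocks_diagonal hM]
  generalize (c • (1 : Matrix m m R) + X)⁻¹ = N at *
  have hone : c • N + X * N = 1 := by simpa [add_mul] using hinv
  simp only [fromBlocks_multiply]
  congr 1
  · simp [add_mul, hS.eq]
  · calc _ = c • N + X * N := by simp [add_comm]
      _ = 1 := hone
  · calc _ = S * (c • N + X * N) := by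
          simp [mul_assoc, mul_add, ← hS.eq]
          simp [← mul_assoc, hSX.eq]
      _ = S := by rw [hone, mul_one]
  · simp [add_mul, add_comm]

end

/-- For the AB-algorithm started at the `2n×2n` block matrices
`A₁ = [[γI, −I], [−S, γI]]`, `B₁ = [[γI, I], [S, γI]]`, if the `Q`-iteration
(`Q₁ = γI`, `Q_{j+1} = (γQ_j + S)(γI + Q_j)⁻¹`) is breakdown-free up to step `k`, then the
AB-algorithm is breakdown-free up to step `k`, and for `1 ≤ j ≤ k`,
`A_j = [[Q_j, −I], [−S, Q_j]]` and `B_j = [[Q_j, I], [S, Q_j]]`. -/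
theorem ab_algorithm_square_root_structure (n : ℕ) (hn : 0 < n)
    (S : Matrix (Fin n) (Fin n) ℂ) (γ : ℝ) (hγ : 0 < γ)
    (Q : ℕ → Matrix (Fin n) (Fin n) ℂ)
    (hQ1 : Q 1 = (γ : ℂ) • (1 : Matrix (Fin n) (Fin n) ℂ))
    (hQrec : ∀ j, 1 ≤ j →
      Q (j + 1) = ((γ : ℂ) • Q j + S) * ((γ : ℂ) • (1 : Matrix (Fin n) (Fin n) ℂ) + Q j)⁻¹)
    (A B : ℕ → Matrix (Fin n ⊕ Fin n) (Fin n ⊕ Fin n) ℂ)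
    (hA1 : A 1 = Matrix.fromBlocks ((γ : ℂ) • (1 : Matrix (Fin n) (Fin n) ℂ)) (-1) (-S)
      ((γ : ℂ) • (1 : Matrix (Fin n) (Fin n) ℂ)))
    (hB1 : B 1 = Matrix.fromBlocks ((γ : ℂ) • (1 : Matrix (Fin n) (Fin n) ℂ)) 1 S
      ((γ : ℂ) • (1 : Matrix (Fin n) (Fin n) ℂ)))
    (hrecA : ∀ j, 1 ≤ j → A (j + 1) = A 1 * (A 1 + B j)⁻¹ * A j)
    (hrecB : ∀ j, 1 ≤ j → B (j + 1) = B j * (A 1 + B j)⁻¹ * B 1)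
    (k : ℕ) (hk : 1 ≤ k)
    (hQinv : ∀ j, 1 ≤ j → j < k →
      IsUnit ((γ : ℂ) • (1 : Matrix (Fin n) (Fin n) ℂ) + Q j)) :
    (∀ j, 1 ≤ j → j < k → IsUnit (A 1 + B j)) ∧
      (∀ j, 1 ≤ j → j ≤ k →
        A j = Matrix.fromBlocks (Q j) (-1) (-S) (Q j) ∧
        B j = Matrix.fromBlocks (Q j) 1 S (Q j)) := by
  have key : ∀ j, 1 ≤ j → j ≤ k → Commute S (Q j) ∧
      A j = Matrix.fromBlocks (Q j) (-1) (-S) (Q j) ∧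
      B j = Matrix.fromBlocks (Q j) 1 S (Q j) := by
    intro j hj
    induction j, hj using Nat.le_induction with
    | base =>
      intro _
      rw [hA1, hB1, hQ1]
      exact ⟨(Commute.one_right S).smul_right _, rfl, rfl⟩
    | succ j hj ih =>
      intro hjk
      obtain ⟨hSQ, hA, hB⟩ := ih (by omega)
      have hM := hQinv j hj (by omega)
      refine ⟨?_, ?_, ?_⟩
      · rw [hQrec j hj]
        exact commute_q_step hSQ
      · rw [hrecA j hj, hA, hB, hA1, hQrec j hj]
        exact fromBlocks_a_step hM hSQ
      · rw [hrecB j hj, hB, hA1, hB1, hQrec j hj]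
        exact fromBlocks_b_step hM hSQ
  refine ⟨fun j hj hjk => ?_, fun j hj hjk => (key j hj hjk).2⟩
  rw [(key j hj hjk.le).2.2, hA1, fromBlocks_a_add_b]
  exact Matrix.isUnit_fromBlocks_diagonal (hQinv j hj hjk)
end

section
/- Let S ∈ ℂ^{n×n} be invertible, let R ∈ ℂ^{n×n} be invertible with R² = S, let γ > 0 be such that γI + R is invertible, and set C = (γI − R)(γI + R)^{-1}. Suppose the Q-iteration is breakdown-free up to step k. Then (Q_k + R)(I − C^k) = 2R and (Q_k − R)(I − C^k) = 2R C^k. Consequently, if I − C^k is invertible, then Q_k = R (I + C^k)(I − C^k)^{-1}, and equivalently Q_k + R is invertible with (Q_k − R)(Q_k + R)^{-1} = C^k. -/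
open Matrix BigOperators

/-- One step of the Q-iteration turns `(Q + R)(1 - D) = 2R` into `(Q' + R)(1 - CD) = 2R`. -/
lemma add_mul_one_sub_step {A : Type*} [Ring A] {a R C D Q Q' : A}
    (haR : Commute a R) (hP : IsUnit (a + R))
    (hCP : (a + R) * C = a - R) (hD : Commute (a + R) (C * D))
    (hQ' : Q' * (a + Q) = a * Q + R ^ 2) (h : (Q + R) * (1 - D) = 2 * R) :
    (Q' + R) * (1 - C * D) = 2 * R := by
  have h1 : (a + Q) * (1 - D) = (1 - C * D) * (a + R) := by
    calc (a + Q) * (1 - D) = (a - R) * (1 - D) + (Q + R) * (1 - D) := by noncomm_ring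
      _ = (a + R) - (a - R) * D := by rw [h]; noncomm_ring
      _ = (a + R) - (a + R) * (C * D) := by rw [← hCP, mul_assoc]
      _ = (1 - C * D) * (a + R) := by rw [hD.eq, sub_mul, one_mul]
  have h2 : (Q' + R) * (a + Q) = (a + R) * (Q + R) := by
    rw [add_mul, hQ', mul_add R, ← haR.eq]
    noncomm_ring
  refine hP.mul_right_cancel ?_
  calc (Q' + R) * (1 - C * D) * (a + R) = (Q' + R) * (a + Q) * (1 - D) := by
        rw [mul_assoc, ← h1, mul_assoc]
    _ = (a + R) * (2 * R) := by rw [h2, mul_assoc, h]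
    _ = 2 * (a * R) + 2 * (R * R) := by noncomm_ring
    _ = 2 * R * (a + R) := by rw [haR.eq]; noncomm_ring

/-- With `R² = S` invertible, `C = (γI − R)(γI + R)⁻¹`, and the Q-iteration
breakdown-free up to step `k`: `(Q_k + R)(I − C^k) = 2R`, `(Q_k − R)(I − C^k) = 2R C^k`;
if `I − C^k` is invertible then `Q_k = R(I + C^k)(I − C^k)⁻¹`, `Q_k + R` is invertible and
`(Q_k − R)(Q_k + R)⁻¹ = C^k`. -/
theorem q_iteration_cayley_formula (n : ℕ) (hn : 0 < n)
    (S R : Matrix (Fin n) (Fin n) ℂ) (hS : IsUnit S) (hR : IsUnit R) (hR2 : R ^ 2 = S)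
    (γ : ℝ) (hγ : 0 < γ)
    (hγR : IsUnit ((γ : ℂ) • (1 : Matrix (Fin n) (Fin n) ℂ) + R))
    (C : Matrix (Fin n) (Fin n) ℂ)
    (hC : C = ((γ : ℂ) • (1 : Matrix (Fin n) (Fin n) ℂ) - R) *
      ((γ : ℂ) • (1 : Matrix (Fin n) (Fin n) ℂ) + R)⁻¹)
    (Q : ℕ → Matrix (Fin n) (Fin n) ℂ)
    (hQ1 : Q 1 = (γ : ℂ) • (1 : Matrix (Fin n) (Fin n) ℂ))
    (hQrec : ∀ j, 1 ≤ j →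
      Q (j + 1) = ((γ : ℂ) • Q j + S) * ((γ : ℂ) • (1 : Matrix (Fin n) (Fin n) ℂ) + Q j)⁻¹)
    (k : ℕ) (hk : 1 ≤ k)
    (hQinv : ∀ j, 1 ≤ j → j < k →
      IsUnit ((γ : ℂ) • (1 : Matrix (Fin n) (Fin n) ℂ) + Q j)) :
    (Q k + R) * (1 - C ^ k) = (2 : ℂ) • R ∧
      (Q k - R) * (1 - C ^ k) = ((2 : ℂ) • R) * C ^ k ∧
      (IsUnit ((1 : Matrix (Fin n) (Fin n) ℂ) - C ^ k) →
        Q k = R * (1 + C ^ k) * (1 - C ^ k)⁻¹ ∧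
        IsUnit (Q k + R) ∧
        (Q k - R) * (Q k + R)⁻¹ = C ^ k) := by
  set a : Matrix (Fin n) (Fin n) ℂ := (γ : ℂ) • 1 with ha
  have ha_comm : ∀ X, Commute a X := fun X => (Commute.one_left X).smul_left _
  have h_smul : ∀ X : Matrix (Fin n) (Fin n) ℂ, (γ : ℂ) • X = a * X := fun X => by simp [ha]
  have h_two : (2 : ℂ) • R = 2 * R := by rw [two_smul, two_mul]
  have hP := (Matrix.isUnit_iff_isUnit_det _).1 hγR
  have hRP : Commute R (a + R) := (ha_comm R).symm.add_right (Commute.refl R)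
  have hRPinv : Commute R (a + R)⁻¹ := by
    refine hγR.mul_left_cancel (hγR.mul_right_cancel ?_)
    rw [← mul_assoc (a + R) R, ← hRP.eq, mul_assoc R, Matrix.mul_nonsing_inv _ hP, mul_one,
      Matrix.mul_nonsing_inv_cancel_left _ _ hP]
  have hRC : Commute R C := by
    rw [hC]
    exact ((ha_comm R).symm.sub_right (Commute.refl R)).mul_right hRPinv
  have hPC : Commute (a + R) C := (ha_comm C).add_left hRC
  have hCP : (a + R) * C = a - R := by
    rw [hPC.eq, hC, Matrix.nonsing_inv_mul_cancel_right _ _ hP]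
  have key : ∀ j, 1 ≤ j → j ≤ k → (Q j + R) * (1 - C ^ j) = 2 * R := by
    intro j hj
    induction j, hj using Nat.le_induction with
    | base =>
      intro _
      rw [hQ1, pow_one, mul_sub, hCP]
      noncomm_ring
    | succ j hj ih =>
      intro hjk
      have hu := (Matrix.isUnit_iff_isUnit_det _).1 (hQinv j hj hjk)
      rw [pow_succ']
      refine add_mul_one_sub_step (ha_comm R) hγR hCP (hPC.mul_right (hPC.pow_right j)) ?_
        (ih (Nat.le_of_succ_le hjk))
      rw [hQrec j hj, Matrix.nonsing_inv_mul_cancel_right _ _ hu, hR2, h_smul]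
  have h1 := key k hk le_rfl
  have h2 : (Q k - R) * (1 - C ^ k) = 2 * R * C ^ k := by
    calc (Q k - R) * (1 - C ^ k) = (Q k + R) * (1 - C ^ k) - 2 * R * (1 - C ^ k) := by noncomm_ring
      _ = 2 * R * C ^ k := by rw [h1]; noncomm_ring
  rw [h_two]
  refine ⟨h1, h2, fun hu => ?_⟩
  have hdet := (Matrix.isUnit_iff_isUnit_det _).1 hu
  have h_unit : IsUnit (Q k + R) := by
    have h2R : IsUnit ((Q k + R) * (1 - C ^ k)) := by
      have h2_unit := (IsUnit.mk0 (2 : ℂ) two_ne_zero).map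
        (algebraMap ℂ (Matrix (Fin n) (Fin n) ℂ))
      rw [map_ofNat] at h2_unit
      rw [h1]
      exact h2_unit.mul hR
    rw [Matrix.isUnit_iff_isUnit_det, Matrix.det_mul] at h2R
    exact (Matrix.isUnit_iff_isUnit_det _).2 (isUnit_of_mul_isUnit_left h2R)
  refine ⟨?_, h_unit, ?_⟩
  · have h3 : R * (1 + C ^ k) = Q k * (1 - C ^ k) := by
      calc R * (1 + C ^ k) = 2 * R - R * (1 - C ^ k) := by noncomm_ring
        _ = Q k * (1 - C ^ k) := by rw [← h1]; noncomm_ring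
    rw [h3, Matrix.mul_nonsing_inv_cancel_right _ _ hdet]
  · have h4 : Q k - R = C ^ k * (Q k + R) := by
      refine hu.mul_right_cancel ?_
      rw [h2, mul_assoc (C ^ k), h1, two_mul, add_mul, mul_add, (hRC.pow_right k).eq]
    rw [h4, Matrix.mul_nonsing_inv_cancel_right _ _ ((Matrix.isUnit_iff_isUnit_det _).1 h_unit)]
end

section
/- Let S ∈ ℂ^{n×n} be invertible, let R ∈ ℂ^{n×n} be invertible with R² = S, and let γ > 0 be such that γI + R is invertible. Let i, j be positive integers, suppose the Q-iteration is breakdown-free up to step max(i,j), and suppose Q_i + R and Q_j + R are invertible. Then ((Q_i − R)(Q_i + R)^{-1})^j = ((Q_j − R)(Q_j + R)^{-1})^i. -/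
open Matrix BigOperators

theorem Commute.matrix_inv_right {n : Type*} [Fintype n] [DecidableEq n] {α : Type*} [CommRing α]
    {A B : Matrix n n α} (h : Commute A B) (hB : IsUnit B) : Commute A B⁻¹ := by
  obtain ⟨u, rfl⟩ := hB
  rw [← Matrix.coe_units_inv]
  exact h.units_inv_right

/-- One step of the Q-iteration multiplies the Cayley-type factor relating `Q - R` and `Q + R`
by `(γI - R)(γI + R)⁻¹`, and preserves commutation with `R`. -/
theorem cayley_factor_step {n : Type*} [Fintype n] [DecidableEq n] {α : Type*} [CommRing α]
    {R Q : Matrix n n α} {γ : α} (k : ℕ) (hγR : IsUnit (γ • (1 : Matrix n n α) + R))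
    (hγQ : IsUnit (γ • (1 : Matrix n n α) + Q)) (hc : Commute Q R)
    (h : Q - R = (Q + R) * ((γ • 1 - R) * (γ • 1 + R)⁻¹) ^ k) :
    Commute ((γ • Q + R ^ 2) * (γ • 1 + Q)⁻¹) R ∧
      (γ • Q + R ^ 2) * (γ • 1 + Q)⁻¹ - R =
        ((γ • Q + R ^ 2) * (γ • 1 + Q)⁻¹ + R) *
          ((γ • 1 - R) * (γ • 1 + R)⁻¹) ^ (k + 1) := by
  have hs (X : Matrix n n α) : Commute X (γ • 1) := (Commute.one_right X).smul_right γ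
  set a := γ • (1 : Matrix n n α) + R with ha
  set b := γ • (1 : Matrix n n α) - R with hb
  set g := γ • (1 : Matrix n n α) + Q with hg
  set c := b * a⁻¹ with hcdef
  have comm_c (X : Matrix n n α) (hX : Commute X R) : Commute X c :=
    ((hs X).sub_right hX).mul_right (((hs X).add_right hX).matrix_inv_right hγR)
  have hRg : Commute R g⁻¹ := ((hs R).add_right hc.symm).matrix_inv_right hγQ
  have hgg : g * g⁻¹ = 1 := Matrix.mul_nonsing_inv g ((Matrix.isUnit_iff_isUnit_det g).1 hγQ)
  have haa : a⁻¹ * a = 1 := Matrix.nonsing_inv_mul a ((Matrix.isUnit_iff_isUnit_det a).1 hγR)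
  have hR : R = R * g * g⁻¹ := by rw [mul_assoc, hgg, mul_one]
  have hsub : (γ • Q + R ^ 2) * g⁻¹ - R = b * (Q - R) * g⁻¹ := by
    rw [show (γ • Q + R ^ 2) * g⁻¹ - R = (γ • Q + R ^ 2) * g⁻¹ - R * g * g⁻¹ by rw [← hR], ← sub_mul]
    congr 1
    simp only [hb, hg, mul_add, sub_mul, mul_sub, pow_two, smul_mul_assoc, mul_smul_comm, one_mul,
      mul_one]
    abel
  have hadd : (γ • Q + R ^ 2) * g⁻¹ + R = a * (Q + R) * g⁻¹ := by
    rw [show (γ • Q + R ^ 2) * g⁻¹ + R = (γ • Q + R ^ 2) * g⁻¹ + R * g * g⁻¹ by rw [← hR], ← add_mul]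
    congr 1
    simp only [ha, hg, mul_add, add_mul, pow_two, smul_mul_assoc, mul_smul_comm, one_mul, mul_one]
    abel
  have hca : b = c * a := by rw [hcdef, mul_assoc, haa, mul_one]
  have haR : Commute a R := (hs R).symm.add_left (Commute.refl R)
  have hQR : Commute (Q + R) R := hc.add_left (Commute.refl R)
  have hac : Commute a c := comm_c a haR
  have hyc : Commute (a * (Q + R)) c := comm_c _ (haR.mul_left hQR)
  have hgc : Commute g⁻¹ c := comm_c _ hRg.symm
  refine ⟨((hc.smul_left γ).add_left ((Commute.refl R).pow_left 2)).mul_left hRg.symm, ?_⟩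
  rw [hsub, hadd, h, hca]
  calc c * a * ((Q + R) * c ^ k) * g⁻¹ = c * (a * (Q + R)) * (c ^ k * g⁻¹) := by
        simp only [mul_assoc]
    _ = (a * (Q + R)) * c * (g⁻¹ * c ^ k) := by rw [hyc.eq, (hgc.pow_right k).eq]
    _ = (a * (Q + R)) * (c * g⁻¹) * c ^ k := by simp only [mul_assoc]
    _ = a * (Q + R) * g⁻¹ * c ^ (k + 1) := by rw [← hgc.eq, pow_succ']; simp only [mul_assoc]

/-- With `R² = S` invertible and the Q-iteration breakdown-free up to step
`max i j`, if `Q_i + R` and `Q_j + R` are invertible, then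
`((Q_i − R)(Q_i + R)⁻¹)^j = ((Q_j − R)(Q_j + R)⁻¹)^i`. -/
theorem q_iteration_cayley_commute (n : ℕ) (hn : 0 < n)
    (S R : Matrix (Fin n) (Fin n) ℂ) (hS : IsUnit S) (hR : IsUnit R) (hR2 : R ^ 2 = S)
    (γ : ℝ) (hγ : 0 < γ)
    (hγR : IsUnit ((γ : ℂ) • (1 : Matrix (Fin n) (Fin n) ℂ) + R))
    (Q : ℕ → Matrix (Fin n) (Fin n) ℂ)
    (hQ1 : Q 1 = (γ : ℂ) • (1 : Matrix (Fin n) (Fin n) ℂ))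
    (hQrec : ∀ j, 1 ≤ j →
      Q (j + 1) = ((γ : ℂ) • Q j + S) * ((γ : ℂ) • (1 : Matrix (Fin n) (Fin n) ℂ) + Q j)⁻¹)
    (i j : ℕ) (hi : 1 ≤ i) (hj : 1 ≤ j)
    (hQinv : ∀ l, 1 ≤ l → l < max i j →
      IsUnit ((γ : ℂ) • (1 : Matrix (Fin n) (Fin n) ℂ) + Q l))
    (hQiR : IsUnit (Q i + R)) (hQjR : IsUnit (Q j + R)) :
    ((Q i - R) * (Q i + R)⁻¹) ^ j = ((Q j - R) * (Q j + R)⁻¹) ^ i := by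
  have key : ∀ k, 1 ≤ k → k ≤ max i j → Commute (Q k) R ∧
      Q k - R = (Q k + R) * (((γ : ℂ) • 1 - R) * ((γ : ℂ) • 1 + R)⁻¹) ^ k := by
    intro k hk
    induction k, hk using Nat.le_induction with
    | base =>
      intro _
      have hcomm : Commute ((γ : ℂ) • (1 : Matrix (Fin n) (Fin n) ℂ)) R :=
        (Commute.one_left R).smul_left _
      have hba : Commute ((γ : ℂ) • 1 + R) ((γ : ℂ) • 1 - R) :=
        ((Commute.refl _).sub_right hcomm).add_left (hcomm.symm.sub_right (Commute.refl R))
      rw [hQ1, pow_one, ← mul_assoc, hba.eq, mul_assoc,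
        Matrix.mul_nonsing_inv _ ((Matrix.isUnit_iff_isUnit_det _).1 hγR), mul_one]
      exact ⟨hcomm, rfl⟩
    | succ k hk ih =>
      intro hkm
      obtain ⟨hc, h⟩ := ih (by omega)
      rw [hQrec k hk, ← hR2]
      exact cayley_factor_step k hγR (hQinv k hk (by omega)) hc h
  have cayley_eq : ∀ k, 1 ≤ k → k ≤ max i j → IsUnit (Q k + R) →
      (Q k - R) * (Q k + R)⁻¹ = (((γ : ℂ) • 1 - R) * ((γ : ℂ) • 1 + R)⁻¹) ^ k := by
    intro k hk hkm hu
    obtain ⟨hc, h⟩ := key k hk hkm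
    have hs : Commute (Q k + R) ((γ : ℂ) • 1) := (Commute.one_right _).smul_right _
    have hQR : Commute (Q k + R) R := hc.add_left (Commute.refl R)
    have hcc := ((hs.sub_right hQR).mul_right
      ((hs.add_right hQR).matrix_inv_right hγR)).pow_right k
    rw [h, hcc.eq, mul_assoc,
      Matrix.mul_nonsing_inv _ ((Matrix.isUnit_iff_isUnit_det _).1 hu), mul_one]
  rw [cayley_eq i hi (le_max_left i j) hQiR, cayley_eq j hj (le_max_right i j) hQjR,
    ← pow_mul, ← pow_mul, mul_comm i j]
end
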